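/- Let X be a real normed space and f : ℝ → X. Assume there exist M ≥ 0, η > 0, A ≥ 0 and a function D : ℝ → ℝ with D(h) ≥ 0 for all h, such that ‖f(t+h) − f(t)‖ ≤ M for all t, h ∈ ℝ, such that for every h ∈ ℝ and all s ≤ t one has ‖f(t+h) − f(t)‖² ≤ exp(−η(t−s))·‖f(s+h) − f(s)‖² + A·D(h), and such that for every ε > 0 there exists l > 0 so that every interval [x, x+l] (x ∈ ℝ) contains some h with D(h) ≤ ε. Then f is Bohr almost periodic, i.e., for every ε > 0 there exists l > 0 such that every interval [x, x+l] (x ∈ ℝ) contains some h with ‖f(t+h) − f(t)‖ ≤ ε for all t ∈ ℝ. -/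

import Mathlib

open Filter Topology in
/-- A function `g` on `ℝ` that is bounded above and satisfies the perturbed exponential decay
`g t ≤ exp (-η (t - s)) g s + c` for all `s ≤ t` is bounded above by `c`. -/
theorem le_of_forall_le_exp_mul_add {g : ℝ → ℝ} {C η c : ℝ} (hη : 0 < η)
    (hC : ∀ t, g t ≤ C)
    (hdec : ∀ s t, s ≤ t → g t ≤ Real.exp (-η * (t - s)) * g s + c) (t : ℝ) :
    g t ≤ c := by
  have hexp : Tendsto (fun r : ℝ => Real.exp (-η * r)) atTop (𝓝 0) :=
    Real.tendsto_exp_atBot.comp (tendsto_id.const_mul_atTop_of_neg (neg_neg_of_pos hη))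
  have hlim : Tendsto (fun r : ℝ => Real.exp (-η * r) * C + c) atTop (𝓝 c) := by
    simpa using (hexp.mul_const C).add_const c
  refine ge_of_tendsto hlim ?_
  filter_upwards [eventually_ge_atTop 0] with r hr
  calc g t ≤ Real.exp (-η * (t - (t - r))) * g (t - r) + c := hdec _ _ (by linarith)
    _ = Real.exp (-η * r) * g (t - r) + c := by rw [sub_sub_cancel]
    _ ≤ Real.exp (-η * r) * C + c := by gcongr; exact hC _

/-- Transfer of Bohr almost periodicity: if the shifted differences of a bounded
trajectory satisfy a perturbed exponential decay with perturbation `A · D h`, and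
the set of `h` with small `D h` is relatively dense, then `f` is Bohr almost
periodic. -/
theorem bohr_almost_periodicity_transfer
    {X : Type*} [NormedAddCommGroup X] [NormedSpace ℝ X]
    (f : ℝ → X) (M η A : ℝ) (hM : 0 ≤ M) (hη : 0 < η) (hA : 0 ≤ A)
    (D : ℝ → ℝ) (hD0 : ∀ h : ℝ, 0 ≤ D h)
    (hbd : ∀ t h : ℝ, ‖f (t + h) - f t‖ ≤ M)
    (hdec : ∀ h s t : ℝ, s ≤ t →
      ‖f (t + h) - f t‖ ^ 2
        ≤ Real.exp (-η * (t - s)) * ‖f (s + h) - f s‖ ^ 2 + A * D h)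
    (hdense : ∀ ε : ℝ, 0 < ε → ∃ l : ℝ, 0 < l ∧
      ∀ x : ℝ, ∃ h ∈ Set.Icc x (x + l), D h ≤ ε) :
    ∀ ε : ℝ, 0 < ε → ∃ l : ℝ, 0 < l ∧
      ∀ x : ℝ, ∃ h ∈ Set.Icc x (x + l), ∀ t : ℝ, ‖f (t + h) - f t‖ ≤ ε := by
  intro ε hε
  have hA1 : 0 < A + 1 := by linarith
  obtain ⟨l, hl, hdense_l⟩ := hdense (ε ^ 2 / (A + 1)) (by positivity)
  refine ⟨l, hl, fun x => ?_⟩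
  obtain ⟨h, hx, hD⟩ := hdense_l x
  refine ⟨h, hx, fun t => ?_⟩
  have hsq : ‖f (t + h) - f t‖ ^ 2 ≤ A * D h :=
    le_of_forall_le_exp_mul_add (g := fun t => ‖f (t + h) - f t‖ ^ 2) hη
      (fun t => pow_le_pow_left₀ (norm_nonneg _) (hbd t h) 2) (hdec h) t
  rw [le_div_iff₀ hA1] at hD
  exact pow_le_pow_iff_left₀ (norm_nonneg _) hε.le two_ne_zero |>.1 (by linarith [hD0 h])
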